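/- Let t ∈ ℤ^ℓ and let O(t) := {(t_{σ(1)} + e·u_1, …, t_{σ(ℓ)} + e·u_ℓ) : σ a permutation of {1,…,ℓ}, u ∈ ℤ^ℓ} be its orbit under the extended affine Weyl group action. If s, s′ ∈ O(t) both satisfy the chain of inequalities s_1 ≤ s_2 ≤ … ≤ s_ℓ ≤ s_1 + e (and likewise for s′), then there exists a unique integer k with s′ = R^k(s), where R(t_1,…,t_ℓ) := (t_2,…,t_ℓ, t_1 + e). -/

import Mathlib

/-- Alcove condition, pairwise form. -/
def Alc (e : ℤ) {ℓ : ℕ} (s : Fin ℓ → ℤ) : Prop :=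
  ∀ i j : Fin ℓ, i ≤ j → s i ≤ s j ∧ s j ≤ s i + e

/-- Counting function of the periodic extension. -/
def cnt (e : ℤ) {ℓ : ℕ} (s : Fin ℓ → ℤ) (x : ℤ) : ℤ := ∑ i, (x - s i) / e

lemma cnt_orbit (e : ℤ) (he : 2 ≤ e) {ℓ : ℕ} (t : Fin ℓ → ℤ) (σ : Equiv.Perm (Fin ℓ))
    (u : Fin ℓ → ℤ) (x : ℤ) :
    cnt e (fun i => t (σ i) + e * u i) x = cnt e t x - ∑ i, u i := by
  unfold cnt
  rw [← Equiv.sum_comp σ (fun i => (x - t i) / e), ← Finset.sum_sub_distrib]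
  refine Finset.sum_congr rfl fun i _ => ?_
  have : x - (t (σ i) + e * u i) = (x - t (σ i)) + e * (-u i) := by ring
  rw [this, Int.add_mul_ediv_left _ _ (by omega)]
  ring

lemma sum_ind (ℓ : ℕ) (i : Fin ℓ) :
    ∑ j : Fin ℓ, (if j < i then (1 : ℤ) else 0) = (i : ℕ) := by
  rw [Finset.sum_boole]
  have : (Finset.univ.filter fun j : Fin ℓ => j < i) = Finset.Iio i := by ext; simp
  rw [this, Fin.card_Iio]

lemma sum_ind' (ℓ : ℕ) (i : Fin ℓ) :
    ∑ j : Fin ℓ, (if j ≤ i then (1 : ℤ) else 0) = (i : ℕ) + 1 := by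
  rw [Finset.sum_boole]
  have : (Finset.univ.filter fun j : Fin ℓ => j ≤ i) = Finset.Iic i := by ext; simp
  rw [this, Fin.card_Iic]; push_cast; rfl

lemma le_iff_cnt (e : ℤ) (he : 2 ≤ e) {ℓ : ℕ} (s : Fin ℓ → ℤ) (h : Alc e s) (i : Fin ℓ) (x : ℤ) :
    s i ≤ x ↔ ((i : ℕ) : ℤ) < cnt e s x + ℓ := by
  have hc : cnt e s x + ℓ = ∑ j, ((x - s j) / e + 1) := by
    simp [cnt, Finset.sum_add_distrib]
  rw [hc]
  constructor
  · intro hx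
    have := sum_ind' ℓ i
    have h2 : ∑ j : Fin ℓ, (if j ≤ i then (1 : ℤ) else 0) ≤ ∑ j, ((x - s j) / e + 1) := by
      refine Finset.sum_le_sum fun j _ => ?_
      split_ifs with hj
      · have := (h j i hj).1
        have := Int.ediv_nonneg (show 0 ≤ x - s j by omega) (show 0 ≤ e by omega)
        omega
      · have := (h i j (by omega)).2
        have : -1 ≤ (x - s j) / e := by
          rw [Int.le_ediv_iff_mul_le (by omega)]; omega
        omega
    omega
  · intro hlt
    by_contra! hx
    have := sum_ind ℓ i
    have h2 : ∑ j, ((x - s j) / e + 1) ≤ ∑ j : Fin ℓ, (if j < i then (1 : ℤ) else 0) := by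
      refine Finset.sum_le_sum fun j _ => ?_
      split_ifs with hj
      · have := (h j i hj.le).2
        have : (x - s j) / e < 1 := by
          rw [Int.ediv_lt_iff_lt_mul (by omega)]; omega
        omega
      · have := (h i j (by omega)).1
        have : (x - s j) / e < 0 := by
          rw [Int.ediv_lt_iff_lt_mul (by omega)]; omega
        omega
    omega

lemma eq_of_cnt (e : ℤ) (he : 2 ≤ e) {ℓ : ℕ} (s s' : Fin ℓ → ℤ) (h : Alc e s) (h' : Alc e s')
    (hc : ∀ x, cnt e s x = cnt e s' x) : s = s' := by
  funext i
  refine eq_of_forall_ge_iff fun x => ?_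
  rw [le_iff_cnt e he s h, le_iff_cnt e he s' h', hc]

lemma cnt_rot (e : ℤ) (he : 2 ≤ e) (n : ℕ) (s r : Fin (n + 1) → ℤ)
    (h1 : ∀ i : Fin n, r i.castSucc = s i.succ) (h2 : r (Fin.last n) = s 0 + e) (x : ℤ) :
    cnt e r x = cnt e s x - 1 := by
  unfold cnt
  rw [Fin.sum_univ_castSucc, Fin.sum_univ_succ, h2]
  simp only [h1]
  have : x - (s 0 + e) = (x - s 0) + e * (-1) := by ring
  rw [this, Int.add_mul_ediv_left _ _ (by omega)]
  ring

lemma alc_rot (e : ℤ) (he : 2 ≤ e) (n : ℕ) (s r : Fin (n + 1) → ℤ)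
    (h1 : ∀ i : Fin n, r i.castSucc = s i.succ) (h2 : r (Fin.last n) = s 0 + e) :
    Alc e r ↔ Alc e s := by
  constructor
  · intro h i j hij
    induction i using Fin.cases with
    | zero =>
      induction j using Fin.cases with
      | zero => omega
      | succ j =>
        have := h j.castSucc (Fin.last n) (Fin.le_last _)
        rw [h1, h2] at this
        omega
    | succ i =>
      induction j using Fin.cases with
      | zero => simp at hij
      | succ j =>
        have := h i.castSucc j.castSucc (by simpa using hij)
        rwa [h1, h1] at this
  · intro h i j hij
    induction j using Fin.lastCases with
    | last =>
      induction i using Fin.lastCases with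
      | last => omega
      | cast i =>
        have := h 0 i.succ (Fin.zero_le _)
        rw [h1, h2]
        omega
    | cast j =>
      induction i using Fin.lastCases with
      | last => exact absurd hij (by simp [Fin.le_def])
      | cast i =>
        rw [h1, h1]
        exact h _ _ (by simpa using hij)


/-- Let `O(t)` be the orbit of `t ∈ ℤ^ℓ` under the extended affine Weyl group action
`t^{σu} = (t_{σ(1)},…,t_{σ(ℓ)}) + e·u`.  If `s, s′ ∈ O(t)` both satisfy
`s_1 ≤ … ≤ s_ℓ ≤ s_1 + e`, then `s′ = R^k(s)` for a unique integer `k`, where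
`R(t_1,…,t_ℓ) = (t_2,…,t_ℓ,t_1+e)`. -/
theorem orbit_unique_rotation_power (e : ℤ) (ℓ : ℕ) (he : 2 ≤ e) (hl : 1 ≤ ℓ)
    (R : (Fin ℓ → ℤ) → Fin ℓ → ℤ)
    (hR : ∀ (t : Fin ℓ → ℤ) (i : Fin ℓ),
      R t i = if h : (i : ℕ) + 1 < ℓ then t ⟨(i : ℕ) + 1, h⟩ else t ⟨0, by omega⟩ + e)
    (t s s' : Fin ℓ → ℤ)
    (hs : ∃ (σ : Equiv.Perm (Fin ℓ)) (u : Fin ℓ → ℤ), s = fun i => t (σ i) + e * u i)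
    (hs' : ∃ (σ : Equiv.Perm (Fin ℓ)) (u : Fin ℓ → ℤ), s' = fun i => t (σ i) + e * u i)
    (hsA : Monotone s ∧ s ⟨ℓ - 1, by omega⟩ ≤ s ⟨0, by omega⟩ + e)
    (hs'A : Monotone s' ∧ s' ⟨ℓ - 1, by omega⟩ ≤ s' ⟨0, by omega⟩ + e)
    (P : Equiv.Perm (Fin ℓ → ℤ)) (hP : ⇑P = R) :
    ∃! k : ℤ, (P ^ k) s = s' := by
  obtain ⟨n, rfl⟩ : ∃ n, ℓ = n + 1 := ⟨ℓ - 1, by omega⟩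
  have h1 : ∀ (t : Fin (n + 1) → ℤ) (i : Fin n), P t i.castSucc = t i.succ := by
    intro t i
    rw [hP, hR, dif_pos (by simp)]
    rfl
  have h2 : ∀ (t : Fin (n + 1) → ℤ), P t (Fin.last n) = t 0 + e := by
    intro t
    rw [hP, hR, dif_neg (by simp)]
    rfl
  have hmk : ∀ s : Fin (n + 1) → ℤ, Monotone s →
      s ⟨n + 1 - 1, by omega⟩ ≤ s ⟨0, by omega⟩ + e → Alc e s := by
    intro s hm hl i j hij
    have a : s ⟨0, by omega⟩ ≤ s i := hm (by simp [Fin.le_def])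
    have b : s j ≤ s ⟨n + 1 - 1, by omega⟩ := hm (by simp only [Fin.le_def]; omega)
    exact ⟨hm hij, by omega⟩
  have A := hmk s hsA.1 hsA.2
  have A' := hmk s' hs'A.1 hs'A.2
  have key : ∀ k : ℤ, Alc e ((P ^ k) s) ∧ ∀ x, cnt e ((P ^ k) s) x = cnt e s x - k := by
    intro k
    induction k using Int.induction_on with
    | zero => simpa using A
    | succ k ih =>
      have hk : (P ^ ((k : ℤ) + 1)) s = P ((P ^ (k : ℤ)) s) := by
        rw [add_comm (k : ℤ) 1, zpow_add, zpow_one, Equiv.Perm.mul_apply]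
      rw [hk]
      refine ⟨(alc_rot e he n _ _ (h1 _) (h2 _)).2 ih.1, fun x => ?_⟩
      rw [cnt_rot e he n _ _ (h1 _) (h2 _), ih.2]
      ring
    | pred k ih =>
      have hk : (P ^ (-(k : ℤ))) s = P ((P ^ (-(k : ℤ) - 1)) s) := by
        rw [← Equiv.Perm.mul_apply, ← zpow_one_add]
        congr 2
        ring
      rw [hk] at ih
      refine ⟨(alc_rot e he n _ _ (h1 _) (h2 _)).1 ih.1, fun x => ?_⟩
      have := ih.2 x
      rw [cnt_rot e he n _ _ (h1 _) (h2 _)] at this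
      omega
  obtain ⟨σ, u, hu⟩ := hs
  obtain ⟨σ', u', hu'⟩ := hs'
  have hc : ∀ x, cnt e s x = cnt e t x - ∑ i, u i := fun x => by rw [hu, cnt_orbit e he]
  have hc' : ∀ x, cnt e s' x = cnt e t x - ∑ i, u' i := fun x => by rw [hu', cnt_orbit e he]
  refine ⟨∑ i, u' i - ∑ i, u i, ?_, ?_⟩
  · refine eq_of_cnt e he _ _ (key _).1 A' fun x => ?_
    rw [(key _).2, hc, hc']
    ring
  · intro k hk
    have h3 := (key k).2 0
    have h4 := hc 0
    have h5 := hc' 0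
    rw [hk] at h3
    omega
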